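/- Suppose I(C) is generated by the five Case 3(a) binomials f1 = x1^{a1} − x2^{a12}x4^{a14}, f2 = x2^{a2} − x1^{a21}x3^{a23}, f3 = x3^{a3} − x1^{a31}x4^{a34}, f4 = x4^{a4} − x2^{a42}x3^{a43}, f5 = x1^{a31}x2^{a42} − x3^{a23}x4^{a14}, where n1 < n2 < n3 < n4, a2 ≤ a21 + a23 and a3 ≤ a31 + a34. Then the ideal I(C)_* of initial forms is generated by one of the following four sets: {x2^{a12}x4^{a14}, x2^{a2}, x3^{a3}, x4^{a4}, x3^{a23}x4^{a14}}, {x2^{a12}x4^{a14}, x2^{a2} − x1^{a21}x3^{a23}, x3^{a3}, x4^{a4}, x3^{a23}x4^{a14}}, {x2^{a12}x4^{a14}, x2^{a2}, x3^{a3} − x1^{a31}x4^{a34}, x4^{a4}, x3^{a23}x4^{a14}}, or {x2^{a12}x4^{a14}, x2^{a2} − x1^{a21}x3^{a23}, x3^{a3} − x1^{a31}x4^{a34}, x4^{a4}, x3^{a23}x4^{a14}}; in particular I(C)_* is minimally generated by five elements. -/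

import Mathlib

open MvPolynomial

/-- The initial form `f_*` of a multivariate polynomial `f`: the homogeneous
component of `f` of least degree (for `f = 0` this is `0`). -/
noncomputable def initialForm {k : Type*} [Field k]
    (f : MvPolynomial (Fin 4) k) : MvPolynomial (Fin 4) k :=
  homogeneousComponent (sInf {n | homogeneousComponent n f ≠ 0}) f

/-- Newman's lemma: a terminating, locally confluent relation has a normal form map. -/
theorem exists_normalForm_of_locallyConfluent {A : Type*} {r : A → A → Prop}
    (wf : WellFounded (flip r))
    (hr : ∀ a b c, r a b → r a c →
      ∃ d, Relation.ReflTransGen r b d ∧ Relation.ReflTransGen r c d) :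
    ∃ N : A → A, (∀ a, Relation.ReflTransGen r a (N a)) ∧ ∀ a b, r a b → N a = N b := by
  have hex : ∀ a, ∃ n, Relation.ReflTransGen r a n ∧ ∀ m, ¬ r n m := by
    intro a
    induction a using wf.induction with
    | _ a ih =>
      by_cases ha : ∀ m, ¬ r a m
      · exact ⟨a, .refl, ha⟩
      · push Not at ha
        obtain ⟨b, hb⟩ := ha
        obtain ⟨n, hbn, hn⟩ := ih b hb
        exact ⟨n, .head hb hbn, hn⟩
  have key : ∀ a, ∃! n, Relation.ReflTransGen r a n ∧ ∀ m, ¬ r n m := by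
    intro a
    induction a using wf.induction with
    | _ a ih =>
      by_cases ha : ∀ m, ¬ r a m
      · refine ⟨a, ⟨.refl, ha⟩, ?_⟩
        rintro n ⟨hn, -⟩
        rcases hn.cases_head with h | ⟨b, hb, -⟩
        · exact h.symm
        · exact absurd hb (ha b)
      · push Not at ha
        obtain ⟨b, hb⟩ := ha
        obtain ⟨n, ⟨hbn, hn⟩, hbu⟩ := ih b hb
        refine ⟨n, ⟨.head hb hbn, hn⟩, ?_⟩
        rintro n' ⟨han', hn'⟩
        rcases han'.cases_head with rfl | ⟨c, hc, hcn'⟩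
        · exact absurd hb (hn' b)
        · obtain ⟨d, hbd, hcd⟩ := hr a b c hb hc
          obtain ⟨z, ⟨hcz, hz⟩, hcu⟩ := ih c hc
          have hn'z : n' = z := hcu n' ⟨hcn', hn'⟩
          obtain ⟨y, hdy, hy⟩ := hex d
          rw [hn'z, ← hcu y ⟨hcd.trans hdy, hy⟩, hbu y ⟨hbd.trans hdy, hy⟩]
  choose N hN hNu using key
  refine ⟨N, fun a => (hN a).1, fun a b hab => ?_⟩
  exact (hNu a (N b) ⟨.head hab (hN b).1, (hN b).2⟩).symm

/-- The linear extension of a function on exponents that is constant on the classes of the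
congruence generated by `α l ~ β l` kills the ideal generated by the corresponding binomials. -/
theorem sum_coeff_smul_eq_zero_of_mem_span {σ ι k V : Type*} [Field k] [AddCommGroup V] [Module k V]
    {α β : ι → σ →₀ ℕ} (N : (σ →₀ ℕ) → V) (hN : ∀ l w, N (w + α l) = N (w + β l))
    {f : MvPolynomial σ k}
    (hf : f ∈ Ideal.span (Set.range fun l => monomial (α l) (1 : k) - monomial (β l) 1)) :
    ∑ u ∈ f.support, coeff u f • N u = 0 := by
  have hmon : ∀ u (c : k), (basisMonomials σ k).constr k N (monomial u c) = c • N u := by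
    intro u c
    have h : monomial u c = c • basisMonomials σ k u := by simp [smul_monomial]
    rw [h, map_smul, Module.Basis.constr_basis]
  suffices h : ∀ p, (basisMonomials σ k).constr k N (p * f) = 0 by
    have h1 := h 1
    rw [one_mul, f.as_sum, map_sum] at h1
    simpa only [hmon] using h1
  induction hf using Submodule.span_induction with
  | mem x hx =>
    obtain ⟨l, rfl⟩ := hx
    intro p
    induction p using MvPolynomial.induction_on' with
    | monomial u c =>
      rw [mul_sub, monomial_mul, monomial_mul, map_sub, hmon, hmon, hN, sub_self]
    | add p q hp hq => rw [add_mul, map_add, hp, hq, add_zero]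
  | zero => simp
  | add x y _ _ hx hy => intro p; rw [mul_add, map_add, hx, hy, add_zero]
  | smul a x _ hx => intro p; rw [smul_eq_mul, ← mul_assoc]; exact hx _

/-- One rewriting step replacing a factor `X ^ α l` of a monomial by `X ^ β l`. -/
def MonomialStep {σ ι : Type*} (α β : ι → σ →₀ ℕ) (u v : σ →₀ ℕ) : Prop :=
  ∃ l w, u = w + α l ∧ v = w + β l

/-- For `α.degree ≤ β.degree`, the form of degree `α.degree` of the binomial
`X ^ α - X ^ β`. -/
noncomputable def lowForm {σ : Type*} (k : Type*) [Field k] (α β : σ →₀ ℕ) : MvPolynomial σ k :=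
  monomial α 1 - if α.degree = β.degree then monomial β 1 else 0

theorem initialForm_monomial_sub {k : Type*} [Field k] {α β : Fin 4 →₀ ℕ}
    (hle : α.degree ≤ β.degree) (hne : α ≠ β) :
    initialForm (monomial α (1 : k) - monomial β 1) = lowForm k α β := by
  have hcomp : homogeneousComponent α.degree (monomial α (1 : k) - monomial β 1)
      = lowForm k α β := by
    ext d
    rw [lowForm, coeff_homogeneousComponent]
    split_ifs with h1 h2 h2 <;> simp only [coeff_sub, coeff_monomial, coeff_zero]
    · have : β ≠ d := fun h => h2 (h ▸ h1.symm)
      simp [this]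
    · have : α ≠ d := fun h => h1 (h ▸ rfl)
      have : β ≠ d := fun h => h1 (h ▸ h2.symm)
      simp [*]
    · have : α ≠ d := fun h => h1 (h ▸ rfl)
      simp [this]
  have hmem : homogeneousComponent α.degree (monomial α (1 : k) - monomial β 1) ≠ 0 := by
    intro h
    have := congrArg (coeff α) h
    rw [coeff_homogeneousComponent] at this
    simp [coeff_monomial, hne.symm] at this
  rw [initialForm, ← hcomp]
  congr 2
  refine le_antisymm (Nat.sInf_le hmem) (le_csInf ⟨_, hmem⟩ fun n hn => ?_)
  by_contra! hlt
  refine hn ?_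
  ext d
  rw [coeff_homogeneousComponent]
  split_ifs with h
  · have h1 : α ≠ d := by rintro rfl; omega
    have h2 : β ≠ d := by rintro rfl; omega
    simp [coeff_monomial, h1, h2]
  · simp

theorem monomial_sub_mem_of_reflTransGen {σ ι k : Type*} [Field k] {α β : ι → σ →₀ ℕ}
    (hle : ∀ l, (α l).degree ≤ (β l).degree) {u v : σ →₀ ℕ}
    (h : Relation.ReflTransGen (MonomialStep α β) u v) :
    u.degree ≤ v.degree ∧
      lowForm k u v ∈ Ideal.span (Set.range fun l => lowForm k (α l) (β l)) := by
  induction h using Relation.ReflTransGen.head_induction_on with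
  | refl => simp [lowForm]
  | head h _ ih =>
    rename_i u' v'
    obtain ⟨l, w, rfl, rfl⟩ := h
    obtain ⟨hd, hm⟩ := ih
    have hl := hle l
    have hg : monomial w (1 : k) * lowForm k (α l) (β l) ∈
        Ideal.span (Set.range fun l => lowForm k (α l) (β l)) :=
      Ideal.mul_mem_left _ _ (Ideal.subset_span ⟨l, rfl⟩)
    simp only [map_add] at hd
    refine ⟨by simp only [map_add]; omega, ?_⟩
    rcases hl.eq_or_lt with heq | hlt
    · have := add_mem hg hm
      simpa [lowForm, heq, mul_sub, monomial_mul] using this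
    · have h1 : w.degree + (α l).degree ≠ v.degree := by omega
      simpa [lowForm, hlt.ne, h1, monomial_mul] using hg

/-- If rewriting `X ^ α l` to `X ^ β l` is terminating and locally confluent and never lowers the
degree, then the binomials `X ^ α l - X ^ β l` form a standard basis. -/
theorem span_initialForm_eq {k ι : Type*} [Field k] {α β : ι → Fin 4 →₀ ℕ}
    (hle : ∀ l, (α l).degree ≤ (β l).degree) (hne : ∀ l, α l ≠ β l)
    (wf : WellFounded (flip (MonomialStep α β)))
    (hr : ∀ a b c, MonomialStep α β a b → MonomialStep α β a c →
      ∃ d, Relation.ReflTransGen (MonomialStep α β) b d ∧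
        Relation.ReflTransGen (MonomialStep α β) c d) :
    Ideal.span {g | ∃ f ∈ Ideal.span (Set.range fun l => monomial (α l) (1 : k) -
      monomial (β l) 1), g = initialForm f} =
      Ideal.span (Set.range fun l => lowForm k (α l) (β l)) := by
  obtain ⟨N, hN, hNs⟩ := exists_normalForm_of_locallyConfluent wf hr
  apply le_antisymm
  · rw [Ideal.span_le]
    rintro _ ⟨f, hf, rfl⟩
    rw [initialForm]
    set m := sInf {n | homogeneousComponent n f ≠ 0} with hm
    have hlow : ∀ u, u.degree < m → coeff u f = 0 := by
      intro u hu
      have h0 : homogeneousComponent u.degree f = 0 := by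
        by_contra h
        exact Nat.notMem_of_lt_sInf hu h
      simpa [coeff_homogeneousComponent] using congrArg (coeff u) h0
    have hzero := sum_coeff_smul_eq_zero_of_mem_span
      (fun u => if (N u).degree = m then monomial (N u) (1 : k) else 0)
      (fun l w => by simp only [hNs _ _ ⟨l, w, rfl, rfl⟩]) hf
    have hsum : ∑ u ∈ f.support, ((if u.degree = m then monomial u (coeff u f) else 0) -
        coeff u f • if (N u).degree = m then monomial (N u) (1 : k) else 0) ∈
        Ideal.span (Set.range fun l => lowForm k (α l) (β l)) := by
      refine Ideal.sum_mem _ fun u _ => ?_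
      obtain ⟨hd, hmem⟩ := monomial_sub_mem_of_reflTransGen (k := k) hle (hN u)
      rcases lt_trichotomy u.degree m with hu | hu | hu
      · simp [hlow u hu]
      · have := Ideal.mul_mem_left _ (C (coeff u f)) hmem
        simpa only [lowForm, hu, if_true, eq_comm (a := m), ← smul_eq_C_mul, smul_sub,
          smul_monomial, smul_eq_mul, mul_one] using this
      · rw [if_neg hu.ne', if_neg (by omega)]
        simp
    rwa [Finset.sum_sub_distrib, hzero, sub_zero, ← Finset.sum_filter,
      ← homogeneousComponent_apply] at hsum
  · rw [Ideal.span_le]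
    rintro _ ⟨l, rfl⟩
    exact Ideal.subset_span
      ⟨_, Ideal.subset_span ⟨l, rfl⟩, (initialForm_monomial_sub (hle l) (hne l)).symm⟩

/-- Lower bound for the number of generators of an ideal, from exponents `e i` whose coefficients
detect the generators `g i` modulo the maximal ideal at the origin. -/
theorem card_le_card_of_span_eq {σ ι k : Type*} [Field k] [Fintype ι] [DecidableEq ι]
    [DecidableEq σ]
    {e : ι → σ →₀ ℕ} {g : ι → MvPolynomial σ k}
    (h : ∀ i j w (c : k), coeff (e i) (monomial w c * g j) = if w = 0 ∧ i = j then c else 0)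
    {S : Finset (MvPolynomial σ k)}
    (hS : Ideal.span (S : Set (MvPolynomial σ k)) = Ideal.span (Set.range g)) :
    Fintype.card ι ≤ S.card := by
  classical
  let φ : MvPolynomial σ k →ₗ[k] (ι → k) := LinearMap.pi fun i => lcoeff k (e i)
  have hg : ∀ p j, φ (p * g j) = constantCoeff p • Pi.single j 1 := by
    intro p j
    induction p using MvPolynomial.induction_on' with
    | monomial u c =>
      ext i
      change coeff (e i) _ = _
      rw [h]
      by_cases hu : u = 0 <;> by_cases hi : i = j <;>
        simp [hu, hi, constantCoeff_monomial]
    | add p q hp hq => rw [add_mul, map_add, hp, hq, map_add, add_smul]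
  have hmul : ∀ f ∈ Ideal.span (Set.range g), ∀ p, φ (p * f) = constantCoeff p • φ f := by
    intro f hf
    induction hf using Submodule.span_induction with
    | mem x hx =>
      obtain ⟨j, rfl⟩ := hx
      intro p
      rw [hg, ← one_mul (g j), hg]
      simp
    | zero => simp
    | add x y _ _ hx hy => intro p; rw [mul_add, map_add, hx, hy, map_add, smul_add]
    | smul a x _ hx =>
      intro p
      rw [smul_eq_mul, ← mul_assoc, hx, hx, map_mul, mul_smul]
  have hspan : ∀ f ∈ Ideal.span (S : Set (MvPolynomial σ k)),
      φ f ∈ Submodule.span k ((S.image φ : Finset (ι → k)) : Set (ι → k)) := by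
    intro f hf
    induction hf using Submodule.span_induction with
    | mem x hx => exact Submodule.subset_span (by simpa using ⟨x, hx, rfl⟩)
    | zero => simp
    | add x y _ _ hx hy => rw [map_add]; exact add_mem hx hy
    | smul a x hx' hx =>
      rw [smul_eq_mul, hmul x (hS ▸ hx')]
      exact Submodule.smul_mem _ _ hx
  have htop : Submodule.span k ((S.image φ : Finset (ι → k)) : Set (ι → k)) = ⊤ := by
    rw [eq_top_iff, ← (Pi.basisFun k ι).span_eq, Submodule.span_le]
    rintro _ ⟨j, rfl⟩
    have := hspan (g j) (hS ▸ Ideal.subset_span ⟨j, rfl⟩)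
    rw [← one_mul (g j), hg] at this
    simpa using this
  have := finrank_span_finset_le_card (R := k) (S.image φ)
  rw [Set.finrank, htop, finrank_top, Module.finrank_fintype_fun_eq_card] at this
  exact this.trans Finset.card_image_le

theorem coeff_monomial_mul_lowForm {σ ι k : Type*} [Field k] [DecidableEq ι] [DecidableEq σ]
    {α β : ι → σ →₀ ℕ} (hα : ∀ i j, α j ≤ α i → i = j) (hβ : ∀ i j, ¬ β j ≤ α i)
    (i j : ι) (w : σ →₀ ℕ) (c : k) :
    coeff (α i) (monomial w c * lowForm k (α j) (β j)) = if w = 0 ∧ i = j then c else 0 := by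
  have h1 : w + α j = α i ↔ w = 0 ∧ i = j := by
    constructor
    · intro h
      obtain rfl := hα i j (h ▸ le_add_self)
      simpa using h
    · rintro ⟨rfl, rfl⟩; simp
  have h2 : w + β j ≠ α i := fun h => hβ i j (h ▸ le_add_self)
  rw [lowForm]
  split_ifs <;> simp_all [mul_sub, monomial_mul, coeff_monomial]

/-- The exponent vector of `x1 ^ p * x2 ^ q * x3 ^ r * x4 ^ s`. -/
noncomputable def expVec (p q r s : ℕ) : Fin 4 →₀ ℕ :=
  Finsupp.equivFunOnFinite.symm ![p, q, r, s]

theorem expVec_apply (p q r s : ℕ) (i : Fin 4) : expVec p q r s i = ![p, q, r, s] i := rfl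

theorem degree_expVec (p q r s : ℕ) : (expVec p q r s).degree = p + q + r + s := by
  simp [Finsupp.degree_eq_sum, Fin.sum_univ_four, expVec_apply]

theorem monomial_expVec {k : Type*} [Field k] (p q r s : ℕ) :
    monomial (expVec p q r s) (1 : k) = X 0 ^ p * X 1 ^ q * X 2 ^ r * X 3 ^ s := by
  rw [monomial_eq, Finsupp.prod_fintype _ _ (by simp)]
  simp [Fin.prod_univ_four, expVec_apply]

theorem wellFounded_flip_monomialStep {σ ι : Type*} {α β : ι → σ →₀ ℕ}
    (W D : (σ →₀ ℕ) →+ ℕ) (hW : ∀ l, W (α l) = W (β l)) (hD : ∀ l, D (α l) < D (β l))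
    (hDW : ∀ u, D u ≤ 2 * W u) : WellFounded (flip (MonomialStep α β)) := by
  refine Subrelation.wf (r := InvImage (· < ·) fun u => 2 * W u - D u) ?_
    (InvImage.wf _ wellFounded_lt)
  rintro _ _ ⟨l, w, rfl, rfl⟩
  have h1 := hW l
  have h2 := hD l
  have h3 := hDW (w + β l)
  simp only [InvImage, map_add] at *
  omega

theorem MonomialStep.of_forall {σ ι : Type*} {α β : ι → σ →₀ ℕ} {u v : σ →₀ ℕ} (l : ι)
    (h : ∀ t, α l t ≤ u t ∧ v t + α l t = u t + β l t) : MonomialStep α β u v := by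
  refine ⟨l, u - α l, ?_, ?_⟩ <;> ext t <;> have := h t <;>
    simp only [Finsupp.add_apply, Finsupp.tsub_apply] <;> omega

/-- The exponents of the leading monomials of the Case 3(a) binomials. -/
noncomputable def leadExp (a12 a42 a23 a43 a14 a34 : ℕ) : Fin 5 → Fin 4 →₀ ℕ :=
  ![expVec 0 a12 0 a14, expVec 0 (a12 + a42) 0 0, expVec 0 0 (a23 + a43) 0,
    expVec 0 0 0 (a14 + a34), expVec 0 0 a23 a14]

/-- The exponents of the trailing monomials of the Case 3(a) binomials. -/
noncomputable def tailExp (a21 a31 a42 a23 a43 a34 : ℕ) : Fin 5 → Fin 4 →₀ ℕ :=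
  ![expVec (a21 + a31) 0 0 0, expVec a21 0 a23 0, expVec a31 0 0 a34,
    expVec 0 a42 a43 0, expVec a31 a42 0 0]

theorem joinable_of_lt (a21 a31 a12 a42 a23 a43 a14 a34 : ℕ) {i j : Fin 5} (hij : i < j)
    {w w' : Fin 4 →₀ ℕ}
    (h : w + leadExp a12 a42 a23 a43 a14 a34 i = w' + leadExp a12 a42 a23 a43 a14 a34 j) :
    ∃ d, Relation.ReflTransGen (MonomialStep (leadExp a12 a42 a23 a43 a14 a34)
        (tailExp a21 a31 a42 a23 a43 a34)) (w + tailExp a21 a31 a42 a23 a43 a34 i) d ∧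
      Relation.ReflTransGen (MonomialStep (leadExp a12 a42 a23 a43 a14 a34)
        (tailExp a21 a31 a42 a23 a43 a34)) (w' + tailExp a21 a31 a42 a23 a43 a34 j) d := by
  set α := leadExp a12 a42 a23 a43 a14 a34 with hα
  set β := tailExp a21 a31 a42 a23 a43 a34 with hβ
  have hc : ∀ t, w t + α i t = w' t + α j t := fun t => DFunLike.congr_fun h t
  have commute : (∀ t, α j t ≤ w t) → ∃ d,
      Relation.ReflTransGen (MonomialStep α β) (w + β i) d ∧
      Relation.ReflTransGen (MonomialStep α β) (w' + β j) d := by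
    intro hle
    refine ⟨w + β i - α j + β j, .single (.of_forall j fun t => ?_),
      .single (.of_forall i fun t => ?_)⟩ <;>
    · have := hc t
      have := hle t
      simp only [Finsupp.add_apply, Finsupp.tsub_apply]
      omega
  have step : ∀ {x y : Fin 4 →₀ ℕ} (l : Fin 5),
      (∀ t, α l t ≤ x t ∧ y t + α l t = x t + β l t) →
      Relation.ReflTransGen (MonomialStep α β) x y := fun l hl => .single (.of_forall l hl)
  fin_cases i <;> fin_cases j <;> first | exact absurd hij (by decide) | skip
  all_goals
    simp [hα, hβ, leadExp, tailExp, Fin.forall_fin_succ, expVec_apply] at hc commute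
  all_goals first | (apply commute <;> omega) | clear commute
  · refine ⟨_, .refl, step 4 ?_⟩
    simp [hα, hβ, leadExp, tailExp, Fin.forall_fin_succ, expVec_apply]
    omega
  · refine ⟨_, .refl, (step (y := w' + β 3 - α 1 + β 1) 1 ?_).trans (step 2 ?_)⟩ <;>
    · simp [hα, hβ, leadExp, tailExp, Fin.forall_fin_succ, expVec_apply]
      omega
  · refine ⟨_, .refl, step 1 ?_⟩
    simp [hα, hβ, leadExp, tailExp, Fin.forall_fin_succ, expVec_apply]
    omega
  · refine ⟨_, step 3 ?_, .refl⟩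
    simp [hα, hβ, leadExp, tailExp, Fin.forall_fin_succ, expVec_apply]
    omega
  · refine ⟨_, step 2 ?_, .refl⟩
    simp [hα, hβ, leadExp, tailExp, Fin.forall_fin_succ, expVec_apply]
    omega

theorem locallyConfluent_monomialStep (a21 a31 a12 a42 a23 a43 a14 a34 : ℕ) (a b c : Fin 4 →₀ ℕ)
    (hb : MonomialStep (leadExp a12 a42 a23 a43 a14 a34) (tailExp a21 a31 a42 a23 a43 a34) a b)
    (hc : MonomialStep (leadExp a12 a42 a23 a43 a14 a34) (tailExp a21 a31 a42 a23 a43 a34) a c) :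
    ∃ d, Relation.ReflTransGen (MonomialStep (leadExp a12 a42 a23 a43 a14 a34)
        (tailExp a21 a31 a42 a23 a43 a34)) b d ∧
      Relation.ReflTransGen (MonomialStep (leadExp a12 a42 a23 a43 a14 a34)
        (tailExp a21 a31 a42 a23 a43 a34)) c d := by
  obtain ⟨i, w, rfl, rfl⟩ := hb
  obtain ⟨j, w', h, rfl⟩ := hc
  rcases lt_trichotomy i j with hij | rfl | hij
  · exact joinable_of_lt _ _ _ _ _ _ _ _ hij h
  · rw [add_right_cancel h]
    exact ⟨_, .refl, .refl⟩
  · obtain ⟨d, h1, h2⟩ := joinable_of_lt a21 a31 _ _ _ _ _ _ hij h.symm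
    exact ⟨d, h2, h1⟩

theorem range_fin_five {A : Type*} (f : Fin 5 → A) :
    Set.range f = {f 0, f 1, f 2, f 3, f 4} := by
  ext a
  simp [Fin.exists_fin_succ, eq_comm (b := a)]

theorem weight_fin_four (n1 n2 n3 n4 : ℕ) (u : Fin 4 →₀ ℕ) :
    Finsupp.weight ![n1, n2, n3, n4] u = u 0 * n1 + u 1 * n2 + u 2 * n3 + u 3 * n4 := by
  rw [Finsupp.weight_apply, Finsupp.sum_fintype _ _ (by simp), Fin.sum_univ_four]
  rfl

theorem exponent_eq_of_mem_ker {k : Type*} [Field k] (n : Fin 4 → ℕ) (α β : Fin 4 →₀ ℕ)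
    (h : monomial α (1 : k) - monomial β 1 ∈ RingHom.ker (aeval
      (fun i : Fin 4 => (Polynomial.X : Polynomial k) ^ n i))) :
    Finsupp.weight n α = Finsupp.weight n β := by
  have hmon : ∀ u : Fin 4 →₀ ℕ, aeval (fun i : Fin 4 => (Polynomial.X : Polynomial k) ^ n i)
      (monomial u (1 : k)) = Polynomial.X ^ Finsupp.weight n u := by
    intro u
    rw [aeval_monomial, map_one, one_mul, Finsupp.weight_apply, Finsupp.prod_fintype _ _ (by simp),
      Finsupp.sum_fintype _ _ (by simp), ← Finset.prod_pow_eq_pow_sum]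
    simp [← pow_mul, mul_comm]
  rw [RingHom.mem_ker, map_sub, hmon, hmon, sub_eq_zero] at h
  simpa using congrArg Polynomial.natDegree h

theorem degree_le_two_mul_weight {n1 n2 n3 n4 : ℕ} (h1 : 0 < n1) (h2 : 0 < n2) (h3 : 0 < n3)
    (h4 : 0 < n4) (u : Fin 4 →₀ ℕ) :
    u.degree + u 0 ≤ 2 * Finsupp.weight ![n1, n2, n3, n4] u := by
  rw [weight_fin_four, Finsupp.degree_eq_sum, Fin.sum_univ_four]
  have := Nat.le_mul_of_pos_right (u 0) h1
  have := Nat.le_mul_of_pos_right (u 1) h2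
  have := Nat.le_mul_of_pos_right (u 2) h3
  have := Nat.le_mul_of_pos_right (u 3) h4
  omega

theorem tangent_cone_generators_case_3a
    (k : Type*) [Field k]
    (n1 n2 n3 n4 : ℕ)
    (hn1 : 0 < n1) (hn12 : n1 < n2) (hn23 : n2 < n3) (hn34 : n3 < n4)
    (hgcd : Nat.gcd (Nat.gcd (Nat.gcd n1 n2) n3) n4 = 1)
    (a21 a31 a12 a42 a23 a43 a14 a34 a1 a2 a3 a4 : ℕ)
    (h21 : 0 < a21) (h31 : 0 < a31) (h12 : 0 < a12) (h42 : 0 < a42)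
    (h23 : 0 < a23) (h43 : 0 < a43) (h14 : 0 < a14) (h34 : 0 < a34)
    (ha1 : a1 = a21 + a31)
    (ha2 : a2 = a12 + a42)
    (ha3 : a3 = a23 + a43)
    (ha4 : a4 = a14 + a34)
    (hb21 : a21 < a1) (hb31 : a31 < a1) (hb12 : a12 < a2) (hb42 : a42 < a2)
    (hb23 : a23 < a3) (hb43 : a43 < a3) (hb14 : a14 < a4) (hb34 : a34 < a4)
    (hc1 : a2 ≤ a21 + a23)
    (hc2 : a3 ≤ a31 + a34)
    (x1 x2 x3 x4 : MvPolynomial (Fin 4) k)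
    (hx1 : x1 = X 0) (hx2 : x2 = X 1) (hx3 : x3 = X 2) (hx4 : x4 = X 3)
    (IC : Ideal (MvPolynomial (Fin 4) k))
    (hIC : IC = RingHom.ker (aeval
      (fun i : Fin 4 => (Polynomial.X : Polynomial k) ^ (![n1, n2, n3, n4] i)) :
        MvPolynomial (Fin 4) k →ₐ[k] Polynomial k))
    (hgen : IC = Ideal.span {x1 ^ a1 - x2 ^ a12 * x4 ^ a14,
      x2 ^ a2 - x1 ^ a21 * x3 ^ a23,
      x3 ^ a3 - x1 ^ a31 * x4 ^ a34,
      x4 ^ a4 - x2 ^ a42 * x3 ^ a43,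
      x1 ^ a31 * x2 ^ a42 - x3 ^ a23 * x4 ^ a14})
    (Istar : Ideal (MvPolynomial (Fin 4) k))
    (hIstar : Istar = Ideal.span {g | ∃ f ∈ IC, g = initialForm f}) :
    (Istar = Ideal.span {x2 ^ a12 * x4 ^ a14, x2 ^ a2, x3 ^ a3, x4 ^ a4, x3 ^ a23 * x4 ^ a14} ∨
      Istar = Ideal.span {x2 ^ a12 * x4 ^ a14, x2 ^ a2 - x1 ^ a21 * x3 ^ a23, x3 ^ a3, x4 ^ a4, x3 ^ a23 * x4 ^ a14} ∨
      Istar = Ideal.span {x2 ^ a12 * x4 ^ a14, x2 ^ a2, x3 ^ a3 - x1 ^ a31 * x4 ^ a34, x4 ^ a4, x3 ^ a23 * x4 ^ a14} ∨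
      Istar = Ideal.span {x2 ^ a12 * x4 ^ a14, x2 ^ a2 - x1 ^ a21 * x3 ^ a23, x3 ^ a3 - x1 ^ a31 * x4 ^ a34, x4 ^ a4, x3 ^ a23 * x4 ^ a14}) ∧
    (∃ S : Finset (MvPolynomial (Fin 4) k), S.card = 5 ∧
      Ideal.span (S : Set (MvPolynomial (Fin 4) k)) = Istar) ∧
    (∀ S : Finset (MvPolynomial (Fin 4) k),
      Ideal.span (S : Set (MvPolynomial (Fin 4) k)) = Istar → 5 ≤ S.card) := by
  classical
  subst hx1 hx2 hx3 hx4 ha1 ha2 ha3 ha4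
  set α := leadExp a12 a42 a23 a43 a14 a34 with hα
  set β := tailExp a21 a31 a42 a23 a43 a34 with hβ
  have hIC' : IC = Ideal.span (Set.range fun l => monomial (α l) (1 : k) - monomial (β l) 1) := by
    have hneg : ∀ f g : MvPolynomial (Fin 4) k, Ideal.span {f - g} = Ideal.span {g - f} :=
      fun f g => by rw [← neg_sub, Ideal.span_singleton_neg]
    rw [hgen, range_fin_five]
    simp [hα, hβ, leadExp, tailExp, monomial_expVec]
    simp only [Ideal.span_insert]
    rw [hneg (X 1 ^ a12 * X 3 ^ a14), hneg (X 2 ^ a23 * X 3 ^ a14)]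
  have hw : ∀ l, Finsupp.weight ![n1, n2, n3, n4] (α l) = Finsupp.weight ![n1, n2, n3, n4] (β l) :=
    fun l => exponent_eq_of_mem_ker (k := k) _ _ _
      (hIC ▸ hIC' ▸ Ideal.subset_span ⟨l, rfl⟩)
  have w1 : a12 * n2 + a14 * n4 = (a21 + a31) * n1 := by
    simpa [weight_fin_four, hα, hβ, leadExp, tailExp, expVec_apply] using hw 0
  have w4 : (a14 + a34) * n4 = a42 * n2 + a43 * n3 := by
    simpa [weight_fin_four, hα, hβ, leadExp, tailExp, expVec_apply] using hw 3
  have w5 : a23 * n3 + a14 * n4 = a31 * n1 + a42 * n2 := by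
    simpa [weight_fin_four, hα, hβ, leadExp, tailExp, expVec_apply] using hw 4
  have d1 : a12 + a14 < a21 + a31 := by
    by_contra! h
    nlinarith [Nat.mul_le_mul_left n1 h, Nat.mul_lt_mul_of_pos_right hn12 h12,
      Nat.mul_lt_mul_of_pos_right (hn12.trans (hn23.trans hn34)) h14]
  have d4 : a14 + a34 < a42 + a43 := by
    by_contra! h
    nlinarith [Nat.mul_le_mul_left n4 h, Nat.mul_lt_mul_of_pos_right (hn23.trans hn34) h42,
      Nat.mul_lt_mul_of_pos_right hn34 h43]
  have d5 : a23 + a14 < a31 + a42 := by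
    by_contra! h
    nlinarith [Nat.mul_le_mul_left n2 h, Nat.mul_lt_mul_of_pos_right hn12 h31,
      Nat.mul_lt_mul_of_pos_right hn23 h23,
      Nat.mul_lt_mul_of_pos_right (hn23.trans hn34) h14]
  have hle : ∀ l, (α l).degree ≤ (β l).degree := by
    simp [hα, hβ, leadExp, tailExp, Fin.forall_fin_succ, degree_expVec]
    omega
  have hα_le : ∀ i j, α j ≤ α i → i = j := by
    simp [hα, leadExp, Finsupp.le_def, Fin.forall_fin_succ, expVec_apply]
    omega
  have hβ_le : ∀ i j, ¬ β j ≤ α i := by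
    simp [hα, hβ, leadExp, tailExp, Finsupp.le_def, Fin.forall_fin_succ, expVec_apply]
    omega
  have hne : ∀ l, α l ≠ β l := fun l h => hβ_le l l h.ge
  have hwf : WellFounded (flip (MonomialStep α β)) := by
    refine wellFounded_flip_monomialStep (Finsupp.weight ![n1, n2, n3, n4])
      (Finsupp.degree + Finsupp.applyAddHom 0) hw ?_
      (degree_le_two_mul_weight hn1 (by omega) (by omega) (by omega))
    simp [hα, hβ, leadExp, tailExp, Fin.forall_fin_succ, degree_expVec, expVec_apply]
    omega
  have hstar : Istar = Ideal.span (Set.range fun l => lowForm k (α l) (β l)) := by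
    rw [hIstar, hIC']
    exact span_initialForm_eq hle hne hwf (locallyConfluent_monomialStep _ _ _ _ _ _ _ _)
  have hcoeff := coeff_monomial_mul_lowForm (k := k) hα_le hβ_le
  have hinj : Function.Injective fun l => lowForm k (α l) (β l) := by
    intro i j hij
    have h1 := hcoeff i i 0 1
    have h2 := hcoeff i j 0 1
    simp only at hij
    rw [← hij, h1] at h2
    by_contra hne
    simp [hne] at h2
  have hrange : (Set.range fun l => lowForm k (α l) (β l)) = {X 1 ^ a12 * X 3 ^ a14,
      X 1 ^ (a12 + a42) - (if a12 + a42 = a21 + a23 then X 0 ^ a21 * X 2 ^ a23 else 0),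
      X 2 ^ (a23 + a43) - (if a23 + a43 = a31 + a34 then X 0 ^ a31 * X 3 ^ a34 else 0),
      X 3 ^ (a14 + a34), X 2 ^ a23 * X 3 ^ a14} := by
    rw [range_fin_five]
    simp [hα, hβ, leadExp, tailExp, lowForm, degree_expVec, monomial_expVec,
      d1.ne, d4.ne, d5.ne]
  refine ⟨?_, ⟨Finset.univ.image fun l => lowForm k (α l) (β l), ?_, ?_⟩, fun S hS => ?_⟩
  · rw [hstar, hrange]
    by_cases e2 : a12 + a42 = a21 + a23 <;> by_cases e3 : a23 + a43 = a31 + a34 <;>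
      simp only [e2, e3, if_true, if_false, sub_zero, true_or, or_true]
  · rw [Finset.card_image_of_injective _ hinj, Finset.card_univ, Fintype.card_fin]
  · rw [hstar, Finset.coe_image, Finset.coe_univ, Set.image_univ]
  · simpa using card_le_card_of_span_eq hcoeff (hS.trans hstar)
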